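/- One has 2·τ((δ−1)(pq−1)) = −δ² + 3δ − 1 + (−δ² + 3δ − 2)/(pq) − (p² + q² − 3p − 3q − 2)/(6pq) − ⌈δ/p⌉ − ⌈δ/q⌉ + c + (1/2)·ε_{p,q}(δ−1) + 2·s(p, q; (δ−1)/q, 0) + 2·s(q, p; (δ−1)/p, 0). -/

import Mathlib

/-- The sawtooth function `((x))`: it is `0` for integers `x`, and `x - ⌊x⌋ - 1/2` otherwise. -/
noncomputable def saw (x : ℝ) : ℝ := if Int.fract x = 0 then 0 else Int.fract x - 1/2

/-- The generalized Dedekind sum `s(a, b; x, y) = Σ_{i=0}^{b-1} (((i+y)/b))·((a(i+y)/b + x))`. -/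
noncomputable def dsum (a b : ℤ) (x y : ℝ) : ℝ :=
  ∑ i ∈ Finset.range b.toNat,
    saw (((i : ℝ) + y) / (b : ℝ)) * saw ((a : ℝ) * ((i : ℝ) + y) / (b : ℝ) + x)

/-- `Δ_j = 1 + 2j − ⌈jp'/p⌉ − ⌈jq'/q⌉ − ⌈j(pq−2)/(pq−1)⌉`, the increment of the τ-function of
the negative definite Seifert manifold `Σ(−2,(p,p'),(q,q'),(pq−1,pq−2)) = −S³₁(T_{p,q})`. -/
def torusDelta (p q p' q' : ℕ) (j : ℕ) : ℤ :=
  1 + 2 * (j : ℤ) - ⌈((j : ℚ) * (p' : ℚ)) / (p : ℚ)⌉ - ⌈((j : ℚ) * (q' : ℚ)) / (q : ℚ)⌉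
    - ⌈((j : ℚ) * ((p : ℚ) * (q : ℚ) - 2)) / ((p : ℚ) * (q : ℚ) - 1)⌉

/-- `τ(m) = Σ_{j=0}^{m−1} Δ_j`. -/
def torusTau (p q p' q' : ℕ) (m : ℕ) : ℤ := ∑ j ∈ Finset.range m, torusDelta p q p' q' j

/-- The numerical semigroup generated by `p` and `q` (containing `0`). -/
def torusSemigroup (p q : ℕ) : Set ℕ := {s | ∃ a b : ℕ, s = a * p + b * q}


lemma saw_int (b : ℤ) (hb : 0 < b) (x : ℤ) :
    saw ((x : ℝ) / (b : ℝ)) = ((x % b : ℤ) : ℝ) / b - 1/2 + (if b ∣ x then 1/2 else 0) := by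
  have hb' : (0:ℝ) < b := by exact_mod_cast hb
  have hf : Int.fract ((x : ℝ) / (b : ℝ)) = ((x % b : ℤ) : ℝ) / b := by
    rw [Int.fract_eq_iff]
    have h1 := Int.emod_nonneg x hb.ne'
    have h2 := Int.emod_lt_of_pos x hb
    refine ⟨by positivity, ?_, x / b, ?_⟩
    · rw [div_lt_one hb']; exact_mod_cast h2
    · have h3 := Int.emod_add_mul_ediv x b
      have h4 : (x:ℝ) = ((x % b : ℤ) : ℝ) + b * ((x / b : ℤ) : ℝ) := by exact_mod_cast h3.symm
      rw [h4]; field_simp; push_cast; 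
      rw [show ((x:ℝ)) = ((x % b : ℤ) : ℝ) + b * ((x / b : ℤ) : ℝ) from h4] at *
      ring
  unfold saw
  rw [hf]
  by_cases h : b ∣ x
  · rw [Int.emod_eq_zero_of_dvd h]; simp [h]
  · have : x % b ≠ 0 := fun h' => h (Int.dvd_of_emod_eq_zero h')
    rw [if_neg (by
      have : ((x % b : ℤ):ℝ) ≠ 0 := by exact_mod_cast this
      positivity), if_neg h]; ring

lemma saw_mod (b : ℤ) (hb : 0 < b) (x y : ℤ) (h : x % b = y % b) :
    saw ((x : ℝ) / (b : ℝ)) = saw ((y : ℝ) / (b : ℝ)) := by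
  rw [saw_int b hb, saw_int b hb, h]
  congr 1
  have : b ∣ x ↔ b ∣ y := by
    rw [Int.dvd_iff_emod_eq_zero, Int.dvd_iff_emod_eq_zero, h]
  simp [this]

lemma saw_neg_int (b : ℤ) (hb : 0 < b) (x : ℤ) :
    saw (((-x : ℤ) : ℝ) / (b : ℝ)) = - saw ((x : ℝ) / (b : ℝ)) := by
  rw [saw_int b hb, saw_int b hb]
  have hb' : (0:ℝ) < b := by exact_mod_cast hb
  by_cases h : b ∣ x
  · have h' : b ∣ -x := (dvd_neg).2 h
    rw [Int.emod_eq_zero_of_dvd h, Int.emod_eq_zero_of_dvd h']; simp [h]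
  · have h' : ¬ b ∣ -x := fun h' => h ((dvd_neg).1 h')
    have : (-x) % b = b - x % b := by
      rw [Int.neg_emod, if_neg h, Int.natAbs_of_nonneg hb.le]
    rw [if_neg h, if_neg h', this]; push_cast; field_simp; ring

lemma saw_step (b : ℤ) (hb : 2 ≤ b) (x : ℤ) :
    saw (((x + 1 : ℤ) : ℝ) / (b : ℝ)) = saw ((x : ℝ) / (b : ℝ)) + 1 / b
      - (if b ∣ x + 1 then 1/2 else 0) - (if b ∣ x then 1/2 else 0) := by
  have hb0 : 0 < b := by omega
  rw [saw_int b hb0, saw_int b hb0]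
  have hb' : (0:ℝ) < b := by exact_mod_cast hb0
  by_cases h : b ∣ x + 1
  · have h' : ¬ b ∣ x := by
      intro h'
      have := Int.le_of_dvd one_pos ((Int.dvd_add_right h').1 h)
      omega
    have e : x % b = b - 1 := by
      have h1 := Int.emod_nonneg x hb0.ne'
      have h2 := Int.emod_lt_of_pos x hb0
      have h3 : b ∣ x % b + 1 := by
        have : x % b + 1 = (x + 1) - b * (x / b) := by
          have := Int.emod_add_mul_ediv x b; linarith
        rw [this]; exact dvd_sub h (dvd_mul_right _ _)
      have := Int.le_of_dvd (by omega) h3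
      omega
    rw [Int.emod_eq_zero_of_dvd h, e, if_pos h, if_neg h']; push_cast; field_simp; ring
  · have e : (x + 1) % b = x % b + 1 := by
      have h1 := Int.emod_nonneg x hb0.ne'
      have h2 := Int.emod_lt_of_pos x hb0
      have h3 : x % b + 1 ≠ b := by
        intro h3
        apply h
        have := Int.emod_add_mul_ediv x b
        exact ⟨x / b + 1, by linarith⟩
      rw [← Int.emod_add_emod, Int.emod_eq_of_lt (by omega) (by omega)]
    rw [e, if_neg h]; push_cast; field_simp; split_ifs <;> ring

lemma sum_perm (b : ℕ) (hb : 0 < b) (f : ℤ → ℝ) (hf : ∀ x y : ℤ, x % b = y % b → f x = f y)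
    (a c : ℤ) (hab : IsCoprime a (b : ℤ)) :
    ∑ r ∈ Finset.range b, f (c + a * r) = ∑ r ∈ Finset.range b, f r := by
  have hb' : (0:ℤ) < b := by exact_mod_cast hb
  let g : ℕ → ℕ := fun r => ((c + a * r) % b).toNat
  have hg : ∀ r : ℕ, ((g r : ℕ) : ℤ) = (c + a * r) % b := fun r =>
    Int.toNat_of_nonneg (Int.emod_nonneg _ hb'.ne')
  have hm : Set.MapsTo g (Finset.range b : Set ℕ) (Finset.range b : Set ℕ) := by
    intro r _
    simp only [Finset.coe_range, Set.mem_Iio]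
    have := Int.emod_lt_of_pos (c + a * r) hb'
    rw [← hg] at this; exact_mod_cast this
  have hi : Set.InjOn g (Finset.range b : Set ℕ) := by
    intro r hr s hs h
    simp only [Finset.coe_range, Set.mem_Iio] at hr hs
    have h1 : (c + a * r) % b = (c + a * s) % b := by rw [← hg, ← hg, h]
    have h2 : (b:ℤ) ∣ (c + a * r) - (c + a * s) := Int.ModEq.dvd (show Int.ModEq b _ _ from h1.symm)
    have h3 : (b:ℤ) ∣ a * ((r:ℤ) - s) := by convert h2 using 1; ring
    have h4 : (b:ℤ) ∣ (r:ℤ) - s := hab.symm.dvd_of_dvd_mul_left h3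
    have h5 := Int.eq_zero_of_abs_lt_dvd h4 (by rw [abs_lt]; constructor <;> omega)
    omega
  have himg : (Finset.range b).image g = Finset.range b := by
    apply Finset.eq_of_subset_of_card_le
    · intro x hx
      obtain ⟨r, hr, rfl⟩ := Finset.mem_image.1 hx
      exact hm hr
    · rw [Finset.card_image_of_injOn hi]
  calc ∑ r ∈ Finset.range b, f (c + a * r) = ∑ r ∈ Finset.range b, f (g r : ℕ) := by
        apply Finset.sum_congr rfl
        intro r _
        apply hf
        rw [hg, Int.emod_emod_of_dvd _ (dvd_refl _)]
    _ = ∑ x ∈ (Finset.range b).image g, f (x : ℕ) := by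
        rw [Finset.sum_image hi]
    _ = _ := by rw [himg]

lemma sum_periods (b : ℕ) (f : ℤ → ℝ) (hf : ∀ x y : ℤ, x % b = y % b → f x = f y) (t : ℕ) :
    ∑ r ∈ Finset.range (t * b), f r = t * ∑ r ∈ Finset.range b, f r := by
  induction t with
  | zero => simp
  | succ t ih =>
    rw [Nat.succ_mul, Finset.sum_range_add, ih]
    have : ∑ x ∈ Finset.range b, f ((t * b + x : ℕ) : ℤ) = ∑ r ∈ Finset.range b, f r := by
      apply Finset.sum_congr rfl
      intro x _
      apply hf
      push_cast
      rw [add_comm, Int.add_mul_emod_self_right]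
    rw [this]; push_cast; ring

lemma sum_id_real (b : ℕ) : ∑ r ∈ Finset.range b, (r:ℝ) = b * (b - 1) / 2 := by
  induction b with
  | zero => simp
  | succ b ih => rw [Finset.sum_range_succ, ih]; push_cast; ring

lemma sum_sq_real (b : ℕ) : ∑ r ∈ Finset.range b, (r:ℝ)^2 = b * (b - 1) * (2 * b - 1) / 6 := by
  induction b with
  | zero => simp
  | succ b ih => rw [Finset.sum_range_succ, ih]; push_cast; ring

lemma sum_saw (b : ℕ) (hb : 0 < b) : ∑ r ∈ Finset.range b, saw (((r : ℤ) : ℝ) / ((b : ℤ) : ℝ)) = 0 := by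
  have hb' : (0:ℤ) < b := by exact_mod_cast hb
  have hb'' : (0:ℝ) < b := by exact_mod_cast hb
  have h1 := sum_perm b hb (fun x => saw ((x : ℝ) / ((b : ℤ) : ℝ)))
    (fun x y h => saw_mod b hb' x y h) (-1) 0 (isCoprime_one_left.neg_left)
  have h2 : ∀ r : ℕ, saw (((0 + -1 * (r:ℤ) : ℤ) : ℝ) / ((b : ℤ) : ℝ)) = - saw (((r : ℤ) : ℝ) / ((b : ℤ) : ℝ)) := by
    intro r
    rw [← saw_neg_int b hb']; congr 3; ring
  simp only [h2, Finset.sum_neg_distrib] at h1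
  linarith

/-- integer-argument form of the Dedekind-type sum -/
noncomputable def gsum (a b : ℕ) (n : ℕ) : ℝ :=
  ∑ k ∈ Finset.range b, saw (((k : ℤ) : ℝ) / ((b : ℤ) : ℝ)) *
    saw ((((a : ℤ) * k + n : ℤ) : ℝ) / ((b : ℤ) : ℝ))

lemma dsum_eq (a b : ℕ) (hb : 0 < b) (n : ℕ) (x : ℝ) (hx : x = n) :
    dsum (a : ℤ) (b : ℤ) (x / (b : ℝ)) 0 = gsum a b n := by
  have hb'' : (0:ℝ) < b := by exact_mod_cast hb
  subst hx
  unfold dsum gsum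
  rw [Int.toNat_natCast]
  apply Finset.sum_congr rfl
  intro k _
  congr 2
  · push_cast; ring
  · push_cast; ring

lemma isCoprime_of_mul (a a' b : ℕ) (h : ((b : ℕ) : ℤ) ∣ (a : ℤ) * a' - 1) :
    IsCoprime (a' : ℤ) (b : ℤ) := by
  obtain ⟨t, ht⟩ := h
  exact ⟨a, -t, by linarith⟩

lemma sum_indicator (a a' b : ℕ) (hb : 0 < b) (h : ((b : ℕ) : ℤ) ∣ (a : ℤ) * a' - 1) (n : ℕ) :
    ∑ k ∈ Finset.range b, saw (((k : ℤ) : ℝ) / ((b : ℤ) : ℝ)) *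
      (if (b : ℤ) ∣ (a : ℤ) * k + n then (1/2 : ℝ) else 0)
      = - (1/2) * saw (((n * a' : ℤ) : ℝ) / ((b : ℤ) : ℝ)) := by
  have hb' : (0:ℤ) < b := by exact_mod_cast hb
  rw [← sum_perm b hb (fun x => saw ((x : ℝ) / ((b : ℤ) : ℝ)) *
      (if (b : ℤ) ∣ (a : ℤ) * x + n then (1/2 : ℝ) else 0)) _ (a' : ℤ) (-(n * a' : ℤ))
      (isCoprime_of_mul a a' b h)]
  · have key : ∀ k : ℕ, (b : ℤ) ∣ (a : ℤ) * (-(n * a' : ℤ) + a' * k) + n ↔ (b:ℤ) ∣ (k:ℤ) := by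
      intro k
      have e : (a : ℤ) * (-(n * a' : ℤ) + a' * k) + n = (a * a' - 1) * (k - n) + k := by ring
      rw [e]
      exact Int.dvd_add_right (Dvd.dvd.mul_right h _)
    simp only [key]
    rw [Finset.sum_eq_single_of_mem 0 (Finset.mem_range.2 hb)]
    · have := saw_neg_int b hb' (n * a')
      push_cast at this ⊢
      simp [this]; ring
    · intro k hk hk0
      rw [if_neg, mul_zero]
      intro hd
      have := Nat.le_of_dvd (Nat.pos_of_ne_zero hk0) (by exact_mod_cast hd : b ∣ k)
      have := Finset.mem_range.1 hk
      omega
  · intro x y hxy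
    rw [saw_mod b hb' x y hxy]
    have : (b : ℤ) ∣ (a : ℤ) * x + n ↔ (b : ℤ) ∣ (a : ℤ) * y + n := by
      have hd : (b:ℤ) ∣ x - y := Int.ModEq.dvd (show Int.ModEq b _ _ from hxy.symm)
      have e : (a : ℤ) * x + n = a * (x - y) + (a * y + n) := by ring
      rw [e]
      exact Int.dvd_add_right (Dvd.dvd.mul_left hd _)
    simp [this]

lemma gsum_step (a a' b : ℕ) (hb : 2 ≤ b) (h : ((b : ℕ) : ℤ) ∣ (a : ℤ) * a' - 1) (n : ℕ) :
    gsum a b (n + 1) = gsum a b n + 1/2 * (saw (((((n+1:ℕ):ℤ) * a' : ℤ) : ℝ) / ((b : ℤ) : ℝ))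
      + saw ((((n:ℤ) * a' : ℤ) : ℝ) / ((b : ℤ) : ℝ))) := by
  have h1 := sum_indicator a a' b (by omega) h n
  have h2 := sum_indicator a a' b (by omega) h (n+1)
  have h3 := sum_saw b (by omega)
  have e : gsum a b (n+1) = gsum a b n + (1 / ((b:ℤ):ℝ)) * ∑ r ∈ Finset.range b, saw (((r : ℤ) : ℝ) / ((b : ℤ) : ℝ))
     - ∑ k ∈ Finset.range b, saw (((k : ℤ) : ℝ) / ((b : ℤ) : ℝ)) *
      (if (b : ℤ) ∣ (a : ℤ) * k + (n+1:ℕ) then (1/2 : ℝ) else 0)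
     - ∑ k ∈ Finset.range b, saw (((k : ℤ) : ℝ) / ((b : ℤ) : ℝ)) *
      (if (b : ℤ) ∣ (a : ℤ) * k + n then (1/2 : ℝ) else 0) := by
    unfold gsum
    rw [Finset.mul_sum, ← Finset.sum_add_distrib, ← Finset.sum_sub_distrib, ← Finset.sum_sub_distrib]
    apply Finset.sum_congr rfl
    intro k _
    have := saw_step b (by exact_mod_cast hb) ((a:ℤ) * k + n)
    have e2 : ((a:ℤ) * k + (n+1:ℕ)) = (a:ℤ) * k + n + 1 := by push_cast; ring
    rw [e2, this]; ring
  rw [e, h1, h2, h3]; ring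

/-- Sum of the squares of the floors, counted by lattice points. -/
lemma floor_sq_sum (p q : ℕ) (hp : 0 < p) (hq : 0 < q) (hc : Nat.Coprime p q) :
    ∑ k ∈ Finset.range q, (((p * k / q : ℕ)) : ℝ)^2 =
      ∑ l ∈ Finset.range p, (2 * (l:ℝ) - 1) * ((q:ℝ) - 1 - ((q * l / p : ℕ) : ℝ)) + (q - 1) := by
  have h1 : ∀ m : ℕ, m < p → ((m : ℕ) : ℝ)^2 =
      ∑ l ∈ Finset.range p, if 0 < l ∧ l ≤ m then (2 * (l:ℝ) - 1) else 0 := by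
    intro m hm
    rw [← Finset.sum_filter]
    have : (Finset.range p).filter (fun l => 0 < l ∧ l ≤ m) = Finset.Ioc 0 m := by
      ext l; simp only [Finset.mem_filter, Finset.mem_range, Finset.mem_Ioc]; omega
    rw [this]
    clear this hm
    induction m with
    | zero => simp
    | succ m ih => 
      rw [← Finset.insert_Ioc_right_eq_Ioc_add_one (Nat.zero_le m), Finset.sum_insert (by simp), ← ih]; push_cast; ring
  have h2 : ∀ k ∈ Finset.range q, (((p * k / q : ℕ)) : ℝ)^2 = 
      ∑ l ∈ Finset.range p, if 0 < l ∧ l ≤ p * k / q then (2 * (l:ℝ) - 1) else 0 := by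
    intro k hk
    apply h1
    rw [Nat.div_lt_iff_lt_mul hq]
    exact Nat.mul_lt_mul_of_pos_left (Finset.mem_range.1 hk) hp
  rw [Finset.sum_congr rfl h2, Finset.sum_comm]
  have h3 : ∀ l ∈ Finset.range p, (∑ k ∈ Finset.range q, if 0 < l ∧ l ≤ p * k / q then (2 * (l:ℝ) - 1) else 0)
     = (2 * (l:ℝ) - 1) * ((q:ℝ) - 1 - ((q * l / p : ℕ) : ℝ)) + if l = 0 then ((q:ℝ) - 1) else 0 := by
    intro l hl
    rcases Nat.eq_zero_or_pos l with rfl | hl0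
    · simp
    · have hlp := Finset.mem_range.1 hl
      have hlt : q * l / p < q := by
        rw [Nat.div_lt_iff_lt_mul hp]
        exact Nat.mul_lt_mul_of_pos_left hlp hq
      rw [← Finset.sum_filter]
      have : (Finset.range q).filter (fun k => 0 < l ∧ l ≤ p * k / q) = Finset.Ioo (q * l / p) q := by
        ext k
        simp only [Finset.mem_filter, Finset.mem_range, Finset.mem_Ioo]
        rw [Nat.le_div_iff_mul_le hq, Nat.div_lt_iff_lt_mul hp]
        constructor
        · rintro ⟨h1, _, h3⟩
          refine ⟨?_, h1⟩
          rcases Nat.lt_or_ge (q * l) (k * p) with h | h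
          · exact h
          · exfalso
            have e : l * q = p * k := by nlinarith
            have hd : p ∣ l := hc.dvd_of_dvd_mul_right ⟨k, e⟩
            have := Nat.le_of_dvd hl0 hd
            omega
        · rintro ⟨h1, h2⟩
          exact ⟨h2, hl0, by nlinarith⟩
      rw [this, Finset.sum_const, Nat.card_Ioo, if_neg hl0.ne', nsmul_eq_mul]
      have e : q - q * l / p - 1 = q - 1 - q * l / p := by omega
      rw [e, Nat.cast_sub (by omega), Nat.cast_sub (by omega)]; push_cast; ring
  rw [Finset.sum_congr rfl h3, Finset.sum_add_distrib]
  congr 1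
  rw [Finset.sum_ite_eq' ]
  simp [hp]

lemma modsum (p q : ℕ) (hq : 0 < q) (hc : Nat.Coprime p q) (φ : ℝ → ℝ) :
    ∑ k ∈ Finset.range q, φ ((p:ℝ) * k - q * ((p * k / q : ℕ) : ℝ)) = ∑ k ∈ Finset.range q, φ k := by
  have h := sum_perm q hq (fun x => φ ((x % q : ℤ) : ℝ)) (fun x y h => by simp only [h]) p 0
    (Nat.isCoprime_iff_coprime.2 hc)
  simp only [zero_add] at h
  convert h using 1
  · apply Finset.sum_congr rfl
    intro k _
    congr 1
    have : ((p:ℤ) * k) % q = p * k - q * ((p * k / q : ℕ) : ℤ) := by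
      rw [Int.emod_def]; push_cast; ring
    rw [this]; generalize p * k / q = m; push_cast; ring
  · apply Finset.sum_congr rfl
    intro k hk
    congr 1
    rw [Int.emod_eq_of_lt (by positivity) (by exact_mod_cast Finset.mem_range.1 hk)]; simp

lemma gsum_zero (p q : ℕ) (hq : 0 < q) (hc : Nat.Coprime p q) :
    gsum p q 0 = (p:ℝ) / q^2 * ∑ k ∈ Finset.range q, (k:ℝ)^2
      - (1/q) * ∑ k ∈ Finset.range q, (k:ℝ) * ((p * k / q : ℕ) : ℝ) - (q - 1)/4 := by
  have hq' : (0:ℤ) < q := by exact_mod_cast hq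
  have hq'' : (0:ℝ) < q := by exact_mod_cast hq
  have h0 : ∑ k ∈ Finset.range q, saw ((((p : ℤ) * k : ℤ) : ℝ) / ((q : ℤ) : ℝ)) = 0 := by
    have h := sum_perm q hq (fun x => saw ((x : ℝ) / ((q : ℤ) : ℝ)))
      (fun x y h => saw_mod q hq' x y h) p 0 (Nat.isCoprime_iff_coprime.2 hc)
    simp only [zero_add] at h
    rw [h, sum_saw q hq]
  have h1 : gsum p q 0 = ∑ k ∈ Finset.range q, ((p:ℝ) / q^2 * (k:ℝ)^2 - (1/q) * ((k:ℝ) * ((p * k / q : ℕ) : ℝ))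
      - (1/(2*q)) * k) - 1/2 * ∑ k ∈ Finset.range q, saw ((((p : ℤ) * k : ℤ) : ℝ) / ((q : ℤ) : ℝ)) := by
    rw [Finset.mul_sum, ← Finset.sum_sub_distrib]
    unfold gsum
    apply Finset.sum_congr rfl
    intro k hk
    have hk' := Finset.mem_range.1 hk
    rcases Nat.eq_zero_or_pos k with rfl | hk0
    · simp [saw]
    · have hnd : ¬ (q:ℤ) ∣ (k:ℤ) := by
        intro hd
        have := Nat.le_of_dvd hk0 (by exact_mod_cast hd : q ∣ k)
        omega
      have hnd2 : ¬ (q:ℤ) ∣ (p:ℤ) * (k:ℤ) := by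
        intro hd
        exact hnd ((Nat.isCoprime_iff_coprime.2 hc).symm.dvd_of_dvd_mul_left hd)
      have : ((p:ℤ) * k) % q = p * k - q * ((p * k / q : ℕ) : ℤ) := by
        rw [Int.emod_def]; push_cast; ring
      simp only [Nat.cast_zero, add_zero]
      rw [saw_int q hq', saw_int q hq', if_neg hnd, if_neg hnd2, this,
        Int.emod_eq_of_lt (by positivity) (by exact_mod_cast hk')]
      generalize p * k / q = m
      push_cast
      field_simp
      ring
  rw [h1, h0, Finset.sum_sub_distrib, Finset.sum_sub_distrib, ← Finset.mul_sum, ← Finset.mul_sum, ← Finset.mul_sum,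
    sum_id_real]
  field_simp
  ring

lemma reciprocity (p q : ℕ) (hp : 0 < p) (hq : 0 < q) (hc : Nat.Coprime p q) :
    gsum p q 0 + gsum q p 0 = -1/4 + 1/12 * ((p:ℝ)/q + q/p + 1/(p*q)) := by
  have hp'' : (0:ℝ) < p := by exact_mod_cast hp
  have hq'' : (0:ℝ) < q := by exact_mod_cast hq
  rw [gsum_zero p q hq hc, gsum_zero q p hp hc.symm]
  have hsq := modsum p q hq hc (fun x => x^2)
  have hid := modsum q p hp hc.symm (fun x => x)
  have hfl := floor_sq_sum p q hp hq hc
  set U := ∑ k ∈ Finset.range q, (k:ℝ) * ((p * k / q : ℕ) : ℝ) with hU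
  set V := ∑ k ∈ Finset.range p, (k:ℝ) * ((q * k / p : ℕ) : ℝ) with hV
  set Q := ∑ k ∈ Finset.range q, (((p * k / q : ℕ)) : ℝ)^2 with hQ
  have e1 : (p:ℝ)^2 * ∑ k ∈ Finset.range q, (k:ℝ)^2 - 2 * p * q * U + q^2 * Q = ∑ k ∈ Finset.range q, (k:ℝ)^2 := by
    have : (p:ℝ)^2 * ∑ k ∈ Finset.range q, (k:ℝ)^2 - 2 * p * q * U + q^2 * Q =
        ∑ k ∈ Finset.range q, ((p:ℝ) * k - q * ((p * k / q : ℕ) : ℝ))^2 := by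
      rw [hU, hQ, Finset.mul_sum, Finset.mul_sum, Finset.mul_sum, ← Finset.sum_sub_distrib,
        ← Finset.sum_add_distrib]
      apply Finset.sum_congr rfl
      intro k _
      ring
    rw [this]; exact hsq
  have e2 : (q:ℝ) * ∑ k ∈ Finset.range p, (k:ℝ) - p * ∑ k ∈ Finset.range p, ((q * k / p : ℕ) : ℝ) = ∑ k ∈ Finset.range p, (k:ℝ) := by
    rw [Finset.mul_sum, Finset.mul_sum, ← Finset.sum_sub_distrib]; exact hid
  have e3 : Q = 2 * (q - 1) * ∑ k ∈ Finset.range p, (k:ℝ) - p * (q - 1) - 2 * V + ∑ k ∈ Finset.range p, ((q * k / p : ℕ) : ℝ) + (q - 1) := by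
    rw [hfl, hV, Finset.mul_sum, Finset.mul_sum]
    have : (p:ℝ) * (q - 1) = ∑ k ∈ Finset.range p, ((q:ℝ) - 1) := by simp; ring
    rw [this, ← Finset.sum_sub_distrib, ← Finset.sum_sub_distrib, ← Finset.sum_add_distrib]
    congr 1
    apply Finset.sum_congr rfl
    intro l _
    ring
  rw [sum_sq_real] at *
  rw [sum_id_real] at *
  generalize ∑ k ∈ Finset.range p, ((q * k / p : ℕ) : ℝ) = W at *
  have eW : W = ((q:ℝ) - 1) * (p - 1) / 2 := by
    field_simp
    have : (p:ℝ) * (W * 2) = p * ((q - 1) * (p - 1)) := by linarith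
    exact mul_left_cancel₀ hp''.ne' this
  have eU : U = (((p:ℝ)^2 - 1) * (q * (q - 1) * (2 * q - 1) / 6) + q^2 * Q) / (2 * p * q) := by
    rw [eq_div_iff (by positivity)]; linarith
  rw [eU, e3, eW, sum_sq_real]
  field_simp
  ring

lemma delta_real (p q p' q' M : ℕ) (hp : 0 < p) (hq : 0 < q) (hM : 0 < M) (hN : p * q = M + 1)
    (hs : p' * q + q' * p = p * q + 1) (j : ℕ) :
    (torusDelta p q p' q' j : ℝ) = 1 + ((j / M : ℕ) : ℝ) - (j : ℝ) / (p * q)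
      - (((-(j * p' : ℤ)) % p : ℤ) : ℝ) / p - (((-(j * q' : ℤ)) % q : ℤ) : ℝ) / q := by
  have hp'' : (0:ℝ) < p := by exact_mod_cast hp
  have hq'' : (0:ℝ) < q := by exact_mod_cast hq
  have hNq : (p:ℚ) * q = M + 1 := by exact_mod_cast hN
  have c1 : ⌈((j : ℚ) * (p' : ℚ)) / (p : ℚ)⌉ = -((-(j * p' : ℤ)) / (p : ℤ)) := by
    rw [← Rat.ceil_intCast_div_natCast]; push_cast; rfl
  have c2 : ⌈((j : ℚ) * (q' : ℚ)) / (q : ℚ)⌉ = -((-(j * q' : ℤ)) / (q : ℤ)) := by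
    rw [← Rat.ceil_intCast_div_natCast]; push_cast; rfl
  have c3 : ⌈((j : ℚ) * ((p : ℚ) * (q : ℚ) - 2)) / ((p : ℚ) * (q : ℚ) - 1)⌉ = j - ((j / M : ℕ) : ℤ) := by
    have e : ((j : ℚ) * ((p : ℚ) * (q : ℚ) - 2)) / ((p : ℚ) * (q : ℚ) - 1)
        = (((j * (M - 1) : ℤ)) : ℚ) / ((M : ℕ) : ℚ) := by
      rw [hNq]; push_cast; congr 1 <;> ring
    rw [e, Rat.ceil_intCast_div_natCast]
    have : -((j:ℤ) * (M - 1)) = j + (-j) * M := by ring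
    rw [this, Int.add_mul_ediv_right _ _ (by exact_mod_cast hM.ne')]
    push_cast; ring
  unfold torusDelta
  rw [c1, c2, c3]
  have d1 := Int.emod_add_mul_ediv (-(j * p' : ℤ)) p
  have d2 := Int.emod_add_mul_ediv (-(j * q' : ℤ)) q
  have d1' : (((-(j * p' : ℤ)) % p : ℤ) : ℝ) = -(j * p') - p * (((-(j * p' : ℤ)) / p : ℤ) : ℝ) := by
    rw [eq_sub_iff_add_eq]; exact_mod_cast d1
  have d2' : (((-(j * q' : ℤ)) % q : ℤ) : ℝ) = -(j * q') - q * (((-(j * q' : ℤ)) / q : ℤ) : ℝ) := by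
    rw [eq_sub_iff_add_eq]; exact_mod_cast d2
  rw [d1', d2']
  generalize (-(j * p' : ℤ)) / (p:ℤ) = X
  generalize (-(j * q' : ℤ)) / (q:ℤ) = Y
  generalize j / M = Z
  have hs' : (p':ℝ) * q + q' * p = p * q + 1 := by exact_mod_cast hs
  push_cast
  field_simp
  linear_combination (-(j:ℝ)) * hs'

lemma fracsum (b t a' M n : ℕ) (hb : 0 < b) (ht : t * b = M + 1) (hc : IsCoprime (a' : ℤ) (b : ℤ)) :
    ∑ r ∈ Finset.range M, (((-(((n * M + r : ℕ) : ℤ) * a' : ℤ)) % b : ℤ) : ℝ) / b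
      = t * (b - 1) / 2 - (((((n + 1 : ℕ) : ℤ) * a') % b : ℤ) : ℝ) / b := by
  have hb'' : (0:ℝ) < b := by exact_mod_cast hb
  let f : ℤ → ℝ := fun x => ((x % b : ℤ) : ℝ) / b
  have hf : ∀ x y : ℤ, x % b = y % b → f x = f y := fun x y h => by simp only [f, h]
  let g : ℤ → ℝ := fun x => f (-((n * M : ℕ) * a' : ℤ) + (-a') * x)
  have hg : ∀ x y : ℤ, x % b = y % b → g x = g y := fun x y h => by
    apply hf
    exact Int.ModEq.add_left _ (Int.ModEq.mul_left _ h)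
  have h1 := sum_periods b g hg t
  have h2 := sum_perm b hb f hf (-a') (-((n * M : ℕ) * a' : ℤ)) hc.neg_left
  have h3 : ∑ r ∈ Finset.range b, f r = (b - 1) / 2 := by
    have : ∀ r ∈ Finset.range b, f r = (1/b) * (r:ℝ) := by
      intro r hr
      simp only [f]
      rw [Int.emod_eq_of_lt (by positivity) (by exact_mod_cast Finset.mem_range.1 hr)]
      push_cast; ring
    rw [Finset.sum_congr rfl this, ← Finset.mul_sum, sum_id_real]; field_simp
  rw [ht, Finset.sum_range_succ] at h1
  have h4 : g M = (((((n + 1 : ℕ) : ℤ) * a') % b : ℤ) : ℝ) / b := by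
    apply hf
    have : -((n * M : ℕ) * a' : ℤ) + (-a') * (M:ℤ) = ((n + 1 : ℕ) : ℤ) * a' + (-((n+1) * t * a') : ℤ) * b := by
      have : (t:ℤ) * b = M + 1 := by exact_mod_cast ht
      push_cast
      linear_combination (n+1) * (a':ℤ) * this
    rw [this, Int.add_mul_emod_self_right]
  have h5 : ∑ r ∈ Finset.range M, (((-(((n * M + r : ℕ) : ℤ) * a' : ℤ)) % b : ℤ) : ℝ) / b
      = ∑ r ∈ Finset.range M, g r := by
    apply Finset.sum_congr rfl
    intro r _
    simp only [g, f]
    congr 4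
    push_cast; ring
  have h6 : ∑ r ∈ Finset.range b, g r = (b - 1) / 2 := by rw [← h3, ← h2]
  rw [h5, ← h4]
  rw [h6] at h1
  linarith

lemma tau_step (p q p' q' M : ℕ) (hp : 0 < p) (hq : 0 < q) (hM : 0 < M) (hN : p * q = M + 1)
    (hs : p' * q + q' * p = p * q + 1) (hcp : IsCoprime (p' : ℤ) (p : ℤ))
    (hcq : IsCoprime (q' : ℤ) (q : ℤ)) (n : ℕ) :
    (torusTau p q p' q' ((n + 1) * M) : ℝ) = torusTau p q p' q' (n * M) + M * (1 + n)
      - (n * M ^ 2 + M * (M - 1) / 2) / (p * q) - q * (p - 1) / 2 - p * (q - 1) / 2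
      + (((((n + 1 : ℕ) : ℤ) * p') % p : ℤ) : ℝ) / p + (((((n + 1 : ℕ) : ℤ) * q') % q : ℤ) : ℝ) / q := by
  have f1 := fracsum p q p' M n hp (by rw [← hN, mul_comm]) hcp
  have f2 := fracsum q p q' M n hq (by rw [← hN]) hcq
  unfold torusTau
  rw [Nat.succ_mul, Finset.sum_range_add]
  push_cast
  have e : ∀ r ∈ Finset.range M, (torusDelta p q p' q' (n * M + r) : ℝ) =
      (1 + n) - (1 / ((p:ℝ) * q)) * (n * M) - (1 / ((p:ℝ) * q)) * r
      - (((-(((n * M + r : ℕ) : ℤ) * p' : ℤ)) % p : ℤ) : ℝ) / p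
      - (((-(((n * M + r : ℕ) : ℤ) * q' : ℤ)) % q : ℤ) : ℝ) / q := by
    intro r hr
    rw [delta_real p q p' q' M hp hq hM hN hs]
    have : (n * M + r) / M = n := by
      rw [mul_comm, Nat.mul_add_div hM, Nat.div_eq_of_lt (Finset.mem_range.1 hr), add_zero]
    rw [this]
    push_cast; ring
  rw [Finset.sum_congr rfl e, Finset.sum_sub_distrib, Finset.sum_sub_distrib, Finset.sum_sub_distrib,
    f1, f2, ← Finset.mul_sum, sum_id_real, Finset.sum_const, Finset.card_range, nsmul_eq_mul]
  push_cast
  ring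

lemma frac_saw (b a' n : ℕ) (hb : 0 < b) (hc : IsCoprime (a' : ℤ) (b : ℤ)) :
    ((((n : ℤ) * a') % b : ℤ) : ℝ) / b = saw ((((n:ℤ) * a' : ℤ) : ℝ) / ((b : ℤ) : ℝ)) + 1/2
      - (1/2) * (if b ∣ n then 1 else 0) := by
  rw [saw_int b (by exact_mod_cast hb)]
  have : (b:ℤ) ∣ (n:ℤ) * a' ↔ b ∣ n := by
    constructor
    · intro h; exact_mod_cast hc.symm.dvd_of_dvd_mul_right h
    · intro h; exact Dvd.dvd.mul_right (by exact_mod_cast h) _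
  simp only [this]
  split_ifs <;> push_cast <;> ring

lemma tau_closed (p q p' q' M : ℕ) (hp : 2 ≤ p) (hq : 2 ≤ q) (hM : 0 < M) (hN : p * q = M + 1)
    (hs : p' * q + q' * p = p * q + 1) (hdp : (p : ℤ) ∣ (q : ℤ) * p' - 1)
    (hdq : (q : ℤ) ∣ (p : ℤ) * q' - 1) (n : ℕ) :
    2 * (torusTau p q p' q' (n * M) : ℝ) =
      n^2 * (1 - 1 / (p * q)) + n * (p + q - p * q - 1 / (p * q) + 2)
      + 2 * (gsum p q n + gsum q p n) - 2 * (gsum p q 0 + gsum q p 0)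
      + saw ((((n:ℤ) * p' : ℤ) : ℝ) / ((p : ℤ) : ℝ)) + saw ((((n:ℤ) * q' : ℤ) : ℝ) / ((q : ℤ) : ℝ))
      - ((n / p : ℕ) : ℝ) - ((n / q : ℕ) : ℝ) := by
  have hp'' : (0:ℝ) < p := by exact_mod_cast (by omega : 0 < p)
  have hq'' : (0:ℝ) < q := by exact_mod_cast (by omega : 0 < q)
  have hcp := isCoprime_of_mul q p' p hdp
  have hcq := isCoprime_of_mul p q' q hdq
  have hMr : (M:ℝ) = p * q - 1 := by
    rw [eq_sub_iff_add_eq]; exact_mod_cast hN.symm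
  induction n with
  | zero => simp [torusTau, saw]
  | succ n ih =>
    rw [tau_step p q p' q' M (by omega) (by omega) hM hN hs hcp hcq, frac_saw p p' (n+1) (by omega) hcp,
      frac_saw q q' (n+1) (by omega) hcq, gsum_step p q' q hq hdq, gsum_step q p' p hp hdp,
      Nat.succ_div, Nat.succ_div, hMr]
    have i1 : (((n / p + if p ∣ n + 1 then 1 else 0 : ℕ)) : ℝ) = (n / p : ℕ) + (if p ∣ n + 1 then (1:ℝ) else 0) := by
      split_ifs <;> simp
    have i2 : (((n / q + if q ∣ n + 1 then 1 else 0 : ℕ)) : ℝ) = (n / q : ℕ) + (if q ∣ n + 1 then (1:ℝ) else 0) := by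
      split_ifs <;> simp
    rw [i1, i2]
    have hcast : ((n+1 : ℕ):ℝ) = n + 1 := by push_cast; rfl
    simp only [hcast]
    have t : 2 * ((n:ℝ) * (p * q - 1)^2 + (p * q - 1) * (p * q - 1 - 1) / 2) / (p * q) =
        2 * (n:ℝ) * (p * q - 2 + 1 / (p * q)) + (p * q - 3 + 2 / (p * q)) := by
      field_simp; ring
    linear_combination ih - t

lemma frac_semigroup (p q p' q' n : ℕ) (hp : 0 < p) (hq : 0 < q) (hc : Nat.Coprime p q) (hn : n < p * q)
    (hdp : (p : ℤ) ∣ (q : ℤ) * p' - 1) (hdq : (q : ℤ) ∣ (p : ℤ) * q' - 1) [Decidable (n ∈ torusSemigroup p q)] :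
    ((((n : ℤ) * p') % p : ℤ) : ℝ) / p + ((((n : ℤ) * q') % q : ℤ) : ℝ) / q
      = n / (p * q) + (if n ∈ torusSemigroup p q then (0 : ℝ) else 1) := by
  have hp'' : (0:ℝ) < p := by exact_mod_cast hp
  have hq'' : (0:ℝ) < q := by exact_mod_cast hq
  have hpz : (0:ℤ) < p := by exact_mod_cast hp
  have hqz : (0:ℤ) < q := by exact_mod_cast hq
  have hnz : (n:ℤ) < p * q := by exact_mod_cast hn
  have hb0 := Int.emod_nonneg ((n:ℤ) * p') hpz.ne'
  have hb1 := Int.emod_lt_of_pos ((n:ℤ) * p') hpz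
  have ha0 := Int.emod_nonneg ((n:ℤ) * q') hqz.ne'
  have ha1 := Int.emod_lt_of_pos ((n:ℤ) * q') hqz
  have hb2 := Int.emod_add_mul_ediv ((n:ℤ) * p') p
  have ha2 := Int.emod_add_mul_ediv ((n:ℤ) * q') q
  by_cases h : n ∈ torusSemigroup p q
  · rw [if_pos h]
    obtain ⟨x, y, hxy⟩ := h
    have hx : x < q := by
      by_contra hx
      push Not at hx
      nlinarith [Nat.mul_le_mul_right p hx, Nat.zero_le (y * q)]
    have hy : y < p := by
      by_contra hx
      push Not at hx
      nlinarith [Nat.mul_le_mul_right q hx, Nat.zero_le (x * p)]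
    have eb : ((n:ℤ) * p') % p = y := by
      obtain ⟨t, ht⟩ := hdp
      have : (n:ℤ) * p' = y + (x * p' + y * t) * p := by
        rw [hxy]; push_cast; linear_combination (y:ℤ) * ht
      rw [this, Int.add_mul_emod_self_right, Int.emod_eq_of_lt (by positivity) (by exact_mod_cast hy)]
    have ea : ((n:ℤ) * q') % q = x := by
      obtain ⟨t, ht⟩ := hdq
      have : (n:ℤ) * q' = x + (y * q' + x * t) * q := by
        rw [hxy]; push_cast; linear_combination (x:ℤ) * ht
      rw [this, Int.add_mul_emod_self_right, Int.emod_eq_of_lt (by positivity) (by exact_mod_cast hx)]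
    rw [eb, ea, hxy]; push_cast; field_simp; ring
  · rw [if_neg h]
    generalize ((n:ℤ) * p') % p = b at *
    generalize ((n:ℤ) * q') % q = a at *
    have d1 : (p:ℤ) ∣ b * q + a * p - n := by
      obtain ⟨t, ht⟩ := hdp
      refine ⟨n * t - (n * p' / p) * q + a, ?_⟩
      linear_combination (n:ℤ) * ht + (q:ℤ) * hb2
    have d2 : (q:ℤ) ∣ b * q + a * p - n := by
      obtain ⟨t, ht⟩ := hdq
      refine ⟨n * t - (n * q' / q) * p + b, ?_⟩
      linear_combination (n:ℤ) * ht + (p:ℤ) * ha2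
    obtain ⟨t, ht⟩ := (Nat.isCoprime_iff_coprime.2 hc).mul_dvd d1 d2
    have hbq : b * q ≤ (p - 1) * q := by nlinarith
    have hap : a * p ≤ (q - 1) * p := by nlinarith
    have hbq0 : 0 ≤ b * q := by positivity
    have hap0 : 0 ≤ a * p := by positivity
    have hN0 : (0:ℤ) < p * q := by positivity
    have t1 : -1 < t := by
      by_contra hh
      push Not at hh
      nlinarith
    have t2 : t < 2 := by
      by_contra hh
      push Not at hh
      nlinarith
    have t0 : t ≠ 0 := by
      rintro rfl
      apply h
      refine ⟨a.toNat, b.toNat, ?_⟩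
      zify
      rw [Int.toNat_of_nonneg ha0, Int.toNat_of_nonneg hb0]
      linarith
    have t3 : t = 1 := by omega
    subst t3
    have hr : (b:ℝ) * q + a * p - n = p * q * 1 := by exact_mod_cast ht
    field_simp
    linarith

lemma ceil_succ_div (n p : ℕ) (hp : 0 < p) : ⌈((n + 1 : ℕ) : ℝ) / (p : ℝ)⌉ = ((n / p : ℕ) : ℤ) + 1 := by
  have hp'' : (0:ℝ) < p := by exact_mod_cast hp
  rw [Int.ceil_eq_iff]
  have h1 := Nat.div_add_mod n p
  have h2 := Nat.mod_lt n hp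
  generalize n / p = m at *
  constructor
  · rw [lt_div_iff₀ hp'']
    have : m * p < n + 1 := by linarith [mul_comm p m, Nat.zero_le (n % p)]
    push_cast
    have h3 : (m : ℝ) * p < n + 1 := by exact_mod_cast this
    linarith
  · rw [div_le_iff₀ hp'']
    have : n + 1 ≤ (m + 1) * p := by nlinarith
    exact_mod_cast this

open Classical in
/-- the value of `2τ` at the absolute minimum `m_{δ−1} = (δ−1)(pq−1)`:
`2τ(m_min) = −δ²+3δ−1 + (−δ²+3δ−2)/(pq) − (p²+q²−3p−3q−2)/(6pq) − ⌈δ/p⌉ − ⌈δ/q⌉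
  + c + ε_{p,q}(δ−1)/2 + 2s(p,q;(δ−1)/q,0) + 2s(q,p;(δ−1)/p,0)`. -/
theorem two_tau_min_formula (p q : ℕ) (hp : 2 ≤ p) (hpq : p < q) (hcop : Nat.Coprime p q)
    (δ : ℕ) (hδ : 2 * δ = (p - 1) * (q - 1))
    (p' : ℕ) (hp'pos : 0 < p') (hp'lt : p' < p) (hp' : p' * q ≡ 1 [MOD p])
    (q' : ℕ) (hq'pos : 0 < q') (hq'lt : q' < q) (hq' : p * q' ≡ 1 [MOD q]) :
    2 * (torusTau p q p' q' ((δ - 1) * (p * q - 1)) : ℝ) =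
      -(δ : ℝ) ^ 2 + 3 * (δ : ℝ) - 1
        + (-(δ : ℝ) ^ 2 + 3 * (δ : ℝ) - 2) / ((p : ℝ) * (q : ℝ))
        - ((p : ℝ) ^ 2 + (q : ℝ) ^ 2 - 3 * (p : ℝ) - 3 * (q : ℝ) - 2) / (6 * (p : ℝ) * (q : ℝ))
        - (⌈(δ : ℝ) / (p : ℝ)⌉ : ℝ) - (⌈(δ : ℝ) / (q : ℝ)⌉ : ℝ)
        + (if δ - 1 ∈ torusSemigroup p q then (0 : ℝ) else 1)
        + (1 / 2) * ((if p ∣ δ - 1 then (1 : ℝ) else 0) + (if q ∣ δ - 1 then (1 : ℝ) else 0))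
        + 2 * dsum (p : ℤ) (q : ℤ) (((δ : ℝ) - 1) / (q : ℝ)) 0
        + 2 * dsum (q : ℤ) (p : ℤ) (((δ : ℝ) - 1) / (p : ℝ)) 0 := by

  classical
  have hq : 2 ≤ q := by omega
  have hp'' : (0:ℝ) < p := by exact_mod_cast (by omega : 0 < p)
  have hq'' : (0:ℝ) < q := by exact_mod_cast (by omega : 0 < q)
  have hδpos : 0 < δ := by
    have : 0 < (p - 1) * (q - 1) := Nat.mul_pos (by omega) (by omega)
    omega
  obtain ⟨n, rfl⟩ : ∃ n, δ = n + 1 := ⟨δ - 1, by omega⟩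
  have hNpos : 4 ≤ p * q := Nat.mul_le_mul hp hq
  obtain ⟨M, hN⟩ : ∃ M, p * q = M + 1 := ⟨p * q - 1, by omega⟩
  have hM : 0 < M := by omega
  have hdp : (p : ℤ) ∣ (q : ℤ) * p' - 1 := by
    have := (Int.natCast_modEq_iff.2 hp').symm.dvd
    push_cast at this
    rwa [mul_comm] at this
  have hdq : (q : ℤ) ∣ (p : ℤ) * q' - 1 := by
    have := (Int.natCast_modEq_iff.2 hq').symm.dvd
    push_cast at this
    exact this
  have hs : p' * q + q' * p = p * q + 1 := by
    have d1 : (p:ℤ) ∣ p' * q + q' * p - 1 := by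
      obtain ⟨t, ht⟩ := hdp
      exact ⟨t + q', by linear_combination ht⟩
    have d2 : (q:ℤ) ∣ p' * q + q' * p - 1 := by
      obtain ⟨t, ht⟩ := hdq
      exact ⟨t + p', by linear_combination ht⟩
    obtain ⟨t, ht⟩ := (Nat.isCoprime_iff_coprime.2 hcop).mul_dvd d1 d2
    have a1 : (p' : ℤ) * q ≤ (p - 1) * q := by
      have : (p':ℤ) ≤ p - 1 := by omega
      nlinarith
    have a2 : (q' : ℤ) * p ≤ (q - 1) * p := by
      have : (q':ℤ) ≤ q - 1 := by omega
      nlinarith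
    have a3 : (2:ℤ) ≤ p' * q := by exact_mod_cast (by nlinarith : 2 ≤ p' * q)
    have a4 : (2:ℤ) ≤ q' * p := by exact_mod_cast (by nlinarith : 2 ≤ q' * p)
    have hN0 : (0:ℤ) < p * q := by exact_mod_cast (by omega : 0 < p * q)
    have t1 : 0 < t := by
      by_contra hh
      push Not at hh
      nlinarith
    have t2 : t < 2 := by
      by_contra hh
      push Not at hh
      nlinarith
    have t3 : t = 1 := by omega
    subst t3
    zify
    linarith
  have hδr : 2 * ((n:ℝ) + 1) = (p - 1) * (q - 1) := by
    have h1 : ((p - 1 : ℕ) : ℝ) = p - 1 := by rw [Nat.cast_sub (by omega)]; simp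
    have h2 : ((q - 1 : ℕ) : ℝ) = q - 1 := by rw [Nat.cast_sub (by omega)]; simp
    rw [← h1, ← h2]; exact_mod_cast hδ
  have hn : n < p * q := by
    have : (p - 1) * (q - 1) ≤ p * q := Nat.mul_le_mul (by omega) (by omega)
    omega
  have hcp := isCoprime_of_mul q p' p hdp
  have hcq := isCoprime_of_mul p q' q hdq
  have hx : ((n + 1 : ℕ) : ℝ) - 1 = n := by push_cast; ring
  have hMe : p * q - 1 = M := by omega
  have hne : n + 1 - 1 = n := by omega
  rw [dsum_eq p q (by omega) n _ hx, dsum_eq q p (by omega) n _ hx, ceil_succ_div n p (by omega),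
    ceil_succ_div n q (by omega), hMe, hne, tau_closed p q p' q' M hp hq hM hN hs hdp hdq,
    reciprocity p q (by omega) (by omega) hcop]
  have k1 := frac_semigroup p q p' q' n (by omega) (by omega) hcop hn hdp hdq
  rw [frac_saw p p' n (by omega) hcp, frac_saw q q' n (by omega) hcq] at k1
  generalize n / p = m1 at *
  generalize n / q = m2 at *
  push_cast at k1 ⊢
  generalize (if n ∈ torusSemigroup p q then (0 : ℝ) else 1) = C at *
  generalize (if p ∣ n then (1 : ℝ) else 0) = E1 at *
  generalize (if q ∣ n then (1 : ℝ) else 0) = E2 at *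
  have t : (n:ℝ)^2 * (1 - 1 / (p * q)) + n * (p + q - p * q - 1 / (p * q) + 2)
      - 2 * (-1/4 + 1/12 * ((p:ℝ)/q + q/p + 1/(p*q))) + n / (p * q) - 1 =
      -((n:ℝ) + 1) ^ 2 + 3 * ((n:ℝ) + 1) - 1
        + (-((n:ℝ) + 1) ^ 2 + 3 * ((n:ℝ) + 1) - 2) / ((p : ℝ) * (q : ℝ))
        - ((p : ℝ) ^ 2 + (q : ℝ) ^ 2 - 3 * (p : ℝ) - 3 * (q : ℝ) - 2) / (6 * (p : ℝ) * (q : ℝ)) - 2 := by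
    have hn' : (n:ℝ) = (p - 1) * (q - 1) / 2 - 1 := by linarith
    rw [hn']
    field_simp
    ring
  linear_combination t + k1
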